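/- Let ℍ^+ = {ξ ∈ ℝ^{2n+1} : ⟨ξ, ν⟩ > d}, δ(ξ) = ⟨ξ, ν⟩ − d, and W(ξ) = |∇_H δ(ξ)|. For p ≥ 2, every u ∈ C_0^∞(ℍ^+), writing u = δ^{(p-1)/p} v, the Hardy remainder satisfies ∫_{ℍ^+} |∇_H u|^p dξ − ((p-1)/p)^p ∫_{ℍ^+} (W^p/δ^p)|u|^p dξ ≥ (2^{p-1} − 1)^{-1} ∫_{ℍ^+} δ^{p-1} |∇_H v|^p dξ. -/

import Mathlib

open MeasureTheory Real

noncomputable section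

abbrev H (n : ℕ) := (Fin n → ℝ) × (Fin n → ℝ) × ℝ

/-- Coefficient vector of the left-invariant field `X_i` at `ξ`. -/
def Xv (n : ℕ) (i : Fin n) (ξ : H n) : H n := (Pi.single i 1, 0, 2 * ξ.2.1 i)

/-- Coefficient vector of the left-invariant field `Y_i` at `ξ`. -/
def Yv (n : ℕ) (i : Fin n) (ξ : H n) : H n := (0, Pi.single i 1, -(2 * ξ.1 i))

/-- The derivative `X_i f`. -/
def XD (n : ℕ) (i : Fin n) (f : H n → ℝ) (ξ : H n) : ℝ := fderiv ℝ f ξ (Xv n i ξ)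

/-- The derivative `Y_i f`. -/
def YD (n : ℕ) (i : Fin n) (f : H n → ℝ) (ξ : H n) : ℝ := fderiv ℝ f ξ (Yv n i ξ)

/-- Euclidean norm of the horizontal gradient. -/
def hNorm (n : ℕ) (f : H n → ℝ) (ξ : H n) : ℝ :=
  Real.sqrt (∑ i, ((XD n i f ξ) ^ 2 + (YD n i f ξ) ^ 2))

/-- Euclidean inner product on `ℝ^{2n+1}`. -/
def iprod (n : ℕ) (a b : H n) : ℝ :=
  (∑ i, a.1 i * b.1 i) + (∑ i, a.2.1 i * b.2.1 i) + a.2.2 * b.2.2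

/-- Clarkson's inequality in a real inner product space. -/
theorem two_mul_norm_half_rpow_le {E : Type*} [NormedAddCommGroup E] [InnerProductSpace ℝ E]
    {p : ℝ} (hp : 2 ≤ p) (a h : E) :
    2 * ‖a + (2⁻¹ : ℝ) • h‖ ^ p + 2 * ‖(2⁻¹ : ℝ) • h‖ ^ p ≤ ‖a‖ ^ p + ‖a + h‖ ^ p := by
  have hsq : ∀ x : ℝ, 0 ≤ x → x ^ p = (x ^ 2) ^ (p / 2) := by
    intro x hx
    rw [← Real.rpow_natCast, ← Real.rpow_mul hx]
    congr 1
    push_cast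
    ring
  set x := a + (2⁻¹ : ℝ) • h with hx
  set y := (2⁻¹ : ℝ) • h with hy
  have e1 : a = x - y := by simp [hx, hy]
  have e2 : a + h = x + y := by
    rw [hx, hy, add_assoc, ← add_smul]
    norm_num
  have h1 : ‖x‖ ^ p + ‖y‖ ^ p ≤ (‖x‖ ^ 2 + ‖y‖ ^ 2) ^ (p / 2) := by
    rw [hsq _ (norm_nonneg x), hsq _ (norm_nonneg y)]
    exact Real.add_rpow_le_rpow_add (by positivity) (by positivity) (by linarith)
  have h2 : ‖x‖ ^ 2 + ‖y‖ ^ 2 = (1 / 2 : ℝ) * ‖a‖ ^ 2 + (1 / 2 : ℝ) * ‖a + h‖ ^ 2 := by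
    have h4 := norm_add_sq_real x y
    have h5 := norm_sub_sq_real x y
    rw [← e1] at h5
    rw [← e2] at h4
    linarith
  have h3 := (convexOn_rpow (show 1 ≤ p / 2 by linarith)).2
    (Set.mem_Ici.2 (sq_nonneg ‖a‖)) (Set.mem_Ici.2 (sq_nonneg ‖a + h‖))
    (show (0 : ℝ) ≤ 1 / 2 by norm_num) (show (0 : ℝ) ≤ 1 / 2 by norm_num) (by norm_num)
  simp only [smul_eq_mul] at h3
  rw [← h2, ← hsq _ (norm_nonneg _), ← hsq _ (norm_nonneg _)] at h3
  linarith

/-- The supporting-hyperplane inequality for the convex function `‖·‖ ^ p`. -/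
theorem norm_rpow_add_inner_le {E : Type*} [NormedAddCommGroup E] [InnerProductSpace ℝ E]
    {p : ℝ} (hp : 2 ≤ p) (a h : E) :
    ‖a‖ ^ p + p * ‖a‖ ^ (p - 2) * inner ℝ a h ≤ ‖a + h‖ ^ p := by
  rcases eq_or_ne a 0 with rfl | ha
  · rw [norm_zero, Real.zero_rpow (by linarith), inner_zero_left]
    simp only [mul_zero, add_zero]
    positivity
  have hpos : 0 < ‖a‖ := norm_pos_iff.2 ha
  set s := inner ℝ a h / ‖a‖ ^ 2 with hs
  have hin : inner ℝ a h = s * ‖a‖ ^ 2 := by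
    rw [hs]
    field_simp
  have hpw : ‖a‖ ^ (p - 2) * ‖a‖ ^ 2 = ‖a‖ ^ p := by
    rw [← Real.rpow_natCast, ← Real.rpow_add hpos]
    congr 1
    push_cast
    ring
  have hL : ‖a‖ ^ p + p * ‖a‖ ^ (p - 2) * inner ℝ a h = ‖a‖ ^ p * (1 + p * s) := by
    rw [hin, ← hpw]
    ring
  rw [hL]
  rcases le_total (-1) s with h1 | h1
  · have hb := one_add_mul_self_le_rpow_one_add h1 (p := p) (by linarith)
    have hn : ‖a‖ * (1 + s) ≤ ‖a + h‖ := by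
      have := real_inner_le_norm a (a + h)
      rw [inner_add_right, real_inner_self_eq_norm_sq, hin] at this
      refine le_of_mul_le_mul_left ?_ hpos
      linarith
    calc ‖a‖ ^ p * (1 + p * s) ≤ ‖a‖ ^ p * (1 + s) ^ p := by gcongr
      _ = (‖a‖ * (1 + s)) ^ p := (Real.mul_rpow hpos.le (by linarith)).symm
      _ ≤ ‖a + h‖ ^ p :=
        Real.rpow_le_rpow (mul_nonneg hpos.le (by linarith)) hn (by linarith)
  · have : ‖a‖ ^ p * (1 + p * s) ≤ 0 :=
      mul_nonpos_of_nonneg_of_nonpos (by positivity) (by nlinarith)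
    exact this.trans (by positivity)

/-- Lindqvist's inequality: the convexity inequality for `‖·‖ ^ p` with a remainder. -/
theorem norm_rpow_add_inner_add_le {E : Type*} [NormedAddCommGroup E] [InnerProductSpace ℝ E]
    {p : ℝ} (hp : 2 ≤ p) (a h : E) :
    ‖a‖ ^ p + p * ‖a‖ ^ (p - 2) * inner ℝ a h + (2 ^ (p - 1) - 1)⁻¹ * ‖h‖ ^ p
      ≤ ‖a + h‖ ^ p := by
  set r : ℝ := 2 ^ (p - 1) with hr
  have hr2 : 2 ≤ r := by
    have := Real.rpow_le_rpow_of_exponent_le (x := 2) (by norm_num) (show (1 : ℝ) ≤ p - 1 by linarith)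
    simpa using this
  have h2p : (2⁻¹ : ℝ) ^ p = (2 * r)⁻¹ := by
    rw [Real.inv_rpow (by norm_num), hr, Real.rpow_sub (by norm_num)]
    congr 1
    rw [Real.rpow_one]
    ring
  have key : ∀ k : ℕ, ∀ h : E, ‖a‖ ^ p + p * ‖a‖ ^ (p - 2) * inner ℝ a h
      + (r - 1)⁻¹ * (1 - r⁻¹ ^ k) * ‖h‖ ^ p ≤ ‖a + h‖ ^ p := by
    intro k
    induction k with
    | zero => intro h; simpa using norm_rpow_add_inner_le hp a h
    | succ k ih =>
      intro h
      have h1 := ih ((2⁻¹ : ℝ) • h)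
      have h2 := two_mul_norm_half_rpow_le hp a h
      have h3 : ‖(2⁻¹ : ℝ) • h‖ ^ p = (2 * r)⁻¹ * ‖h‖ ^ p := by
        rw [norm_smul, Real.mul_rpow (by positivity) (by positivity), ← h2p]
        norm_num
      rw [inner_smul_right, h3] at h1
      rw [h3] at h2
      have h4 : (r - 1)⁻¹ * (1 - r⁻¹ ^ (k + 1)) * ‖h‖ ^ p
          = 2 * ((r - 1)⁻¹ * (1 - r⁻¹ ^ k) * ((2 * r)⁻¹ * ‖h‖ ^ p))
            + 2 * ((2 * r)⁻¹ * ‖h‖ ^ p) := by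
        have : r - 1 ≠ 0 := by linarith
        have : r ≠ 0 := by linarith
        rw [pow_succ]
        field_simp
        ring
      rw [h4]
      linarith
  have hlim : Filter.Tendsto (fun k : ℕ => ‖a‖ ^ p + p * ‖a‖ ^ (p - 2) * inner ℝ a h
      + (r - 1)⁻¹ * (1 - r⁻¹ ^ k) * ‖h‖ ^ p) Filter.atTop
      (nhds (‖a‖ ^ p + p * ‖a‖ ^ (p - 2) * inner ℝ a h + (r - 1)⁻¹ * (1 - 0) * ‖h‖ ^ p)) := by
    have := tendsto_pow_atTop_nhds_zero_of_lt_one (r := r⁻¹) (by positivity)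
      (inv_lt_one_of_one_lt₀ (by linarith))
    exact ((((this.const_sub 1).const_mul _).mul_const _).const_add _)
  have := le_of_tendsto' hlim fun k => key k h
  simpa using this

/-- The `X_i`-component of the horizontal gradient of `⟨·, ν⟩`. -/
def wX (n : ℕ) (ν : H n) (i : Fin n) (ξ : H n) : ℝ := ν.1 i + 2 * ξ.2.1 i * ν.2.2

/-- The `Y_i`-component of the horizontal gradient of `⟨·, ν⟩`. -/
def wY (n : ℕ) (ν : H n) (i : Fin n) (ξ : H n) : ℝ := ν.2.1 i - 2 * ξ.1 i * ν.2.2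

/-- The squared length of the horizontal gradient of `⟨·, ν⟩`. -/
def wSq (n : ℕ) (ν : H n) (ξ : H n) : ℝ := ∑ i, (wX n ν i ξ ^ 2 + wY n ν i ξ ^ 2)

/-- The horizontal gradient of `⟨·, ν⟩` as a vector field in coordinates. -/
def hV (n : ℕ) (ν : H n) (ξ : H n) : H n :=
  (fun i => wX n ν i ξ, fun i => wY n ν i ξ,
    ∑ i, 2 * (ξ.2.1 i * wX n ν i ξ - ξ.1 i * wY n ν i ξ))

/-- Evaluation of a covector at `ξ` on the horizontal frame. -/
def hProj (n : ℕ) (ξ : H n) : (H n →L[ℝ] ℝ) →ₗ[ℝ] EuclideanSpace ℝ (Fin n ⊕ Fin n) where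
  toFun L := WithLp.toLp 2 (Sum.elim (fun i => L (Xv n i ξ)) (fun i => L (Yv n i ξ)))
  map_add' L M := by ext (i | i) <;> simp
  map_smul' c L := by ext (i | i) <;> simp

/-- The functional `⟨·, ν⟩`. -/
def iprodL (n : ℕ) (ν : H n) : H n →L[ℝ] ℝ :=
  LinearMap.toContinuousLinearMap
    { toFun := fun ξ => iprod n ξ ν
      map_add' := fun a b => by
        simp only [iprod, Prod.fst_add, Prod.snd_add, Pi.add_apply, add_mul,
          Finset.sum_add_distrib]
        ring
      map_smul' := fun c a => by
        simp only [iprod, Prod.smul_fst, Prod.smul_snd, Pi.smul_apply, smul_eq_mul, mul_assoc,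
          RingHom.id_apply, mul_add, Finset.mul_sum] }

theorem iprodL_apply (n : ℕ) (ν ξ : H n) : iprodL n ν ξ = iprod n ξ ν := rfl

theorem iprodL_Xv (n : ℕ) (ν ξ : H n) (i : Fin n) : iprodL n ν (Xv n i ξ) = wX n ν i ξ := by
  simp [iprodL_apply, iprod, Xv, wX, Pi.single_apply]

theorem iprodL_Yv (n : ℕ) (ν ξ : H n) (i : Fin n) : iprodL n ν (Yv n i ξ) = wY n ν i ξ := by
  simp [iprodL_apply, iprod, Yv, wY, Pi.single_apply, sub_eq_add_neg]

theorem hNorm_eq_norm_hProj (n : ℕ) (f : H n → ℝ) (ξ : H n) :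
    hNorm n f ξ = ‖hProj n ξ (fderiv ℝ f ξ)‖ := by
  simp [hNorm, EuclideanSpace.norm_eq, hProj, XD, YD, Finset.sum_add_distrib]

theorem hasFDerivAt_iprod_sub (n : ℕ) (ν ξ : H n) (d : ℝ) :
    HasFDerivAt (fun ζ => iprod n ζ ν - d) (iprodL n ν) ξ :=
  (iprodL n ν).hasFDerivAt.sub_const d

theorem norm_hProj_iprodL_sq (n : ℕ) (ν ξ : H n) : ‖hProj n ξ (iprodL n ν)‖ ^ 2 = wSq n ν ξ := by
  simp [EuclideanSpace.norm_sq_eq, hProj, iprodL_Xv, iprodL_Yv, wSq, Finset.sum_add_distrib]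

theorem hV_eq_sum (n : ℕ) (ν ξ : H n) :
    hV n ν ξ = ∑ i, (wX n ν i ξ • Xv n i ξ + wY n ν i ξ • Yv n i ξ) := by
  refine Prod.ext ?_ (Prod.ext ?_ ?_)
  · ext j
    simp [hV, Xv, Yv, Prod.fst_sum, Finset.sum_apply, Pi.single_apply]
  · ext j
    simp [hV, Xv, Yv, Prod.fst_sum, Prod.snd_sum, Finset.sum_apply, Pi.single_apply]
  · simp only [hV, Xv, Yv, Prod.snd_sum, Prod.snd_add, Prod.smul_snd, smul_eq_mul]
    refine Finset.sum_congr rfl fun i _ => ?_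
    ring

theorem inner_hProj_iprodL (n : ℕ) (ν ξ : H n) (L : H n →L[ℝ] ℝ) :
    inner ℝ (hProj n ξ (iprodL n ν)) (hProj n ξ L) = L (hV n ν ξ) := by
  rw [hV_eq_sum]
  simp [PiLp.inner_apply, hProj, iprodL_Xv, iprodL_Yv, Finset.sum_add_distrib, mul_comm]

theorem hV_eq_sum_basis (n : ℕ) (ν ξ : H n) :
    hV n ν ξ = ∑ i, (wX n ν i ξ • ((Pi.single i 1, 0, 0) : H n)
      + wY n ν i ξ • ((0, Pi.single i 1, 0) : H n)
      + (2 * (ξ.2.1 i * wX n ν i ξ - ξ.1 i * wY n ν i ξ)) • ((0, 0, 1) : H n)) := by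
  refine Prod.ext ?_ (Prod.ext ?_ ?_)
  · ext j
    simp [hV, Prod.fst_sum, Finset.sum_apply, Pi.single_apply]
  · ext j
    simp [hV, Prod.fst_sum, Prod.snd_sum, Finset.sum_apply, Pi.single_apply]
  · simp [hV, Prod.snd_sum]

theorem contDiff_wX (n : ℕ) (ν : H n) (i : Fin n) : ContDiff ℝ 1 (wX n ν i) := by
  unfold wX
  fun_prop

theorem contDiff_wY (n : ℕ) (ν : H n) (i : Fin n) : ContDiff ℝ 1 (wY n ν i) := by
  unfold wY
  fun_prop

theorem contDiff_wSq (n : ℕ) (ν : H n) : ContDiff ℝ 1 (wSq n ν) :=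
  ContDiff.sum fun i _ => ((contDiff_wX n ν i).pow 2).add ((contDiff_wY n ν i).pow 2)

theorem wSq_nonneg (n : ℕ) (ν ξ : H n) : 0 ≤ wSq n ν ξ :=
  Finset.sum_nonneg fun _ _ => by positivity

theorem continuous_hV (n : ℕ) (ν : H n) : Continuous (hV n ν) := by
  have hX := fun i => (contDiff_wX n ν i).continuous
  have hY := fun i => (contDiff_wY n ν i).continuous
  unfold hV
  fun_prop

theorem integrable_mul_fderiv {E : Type*} [NormedAddCommGroup E] [NormedSpace ℝ E]
    [MeasurableSpace E] [BorelSpace E] {μ : Measure E} [IsFiniteMeasureOnCompacts μ]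
    {c f : E → ℝ} (hc : Continuous c) (hf : ContDiff ℝ 1 f) (hfc : HasCompactSupport f) (e : E) :
    Integrable (fun x => c x * fderiv ℝ f x e) μ :=
  Continuous.integrable_of_hasCompactSupport
    (hc.mul ((hf.continuous_fderiv one_ne_zero).clm_apply continuous_const))
    (hfc.fderiv_apply (𝕜 := ℝ) e).mul_left

theorem integral_mul_fderiv_eq_zero {E : Type*} [NormedAddCommGroup E] [NormedSpace ℝ E]
    [MeasurableSpace E] [BorelSpace E] [FiniteDimensional ℝ E] {μ : Measure E}
    [μ.IsAddHaarMeasure] {c f : E → ℝ} (hc : ContDiff ℝ 1 c) (hf : ContDiff ℝ 1 f)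
    (hfc : HasCompactSupport f) (e : E) (hce : ∀ (x : E) (s : ℝ), c (x + s • e) = c x) :
    ∫ x, c x * fderiv ℝ f x e ∂μ = 0 := by
  have h0 : ∀ x, fderiv ℝ c x e = 0 := by
    intro x
    rw [← (hc.differentiable one_ne_zero x).lineDeriv_eq_fderiv]
    simp [lineDeriv, hce]
  rw [integral_mul_fderiv_eq_neg_fderiv_mul_of_integrable]
  · simp [h0]
  · simp [h0]
  · exact integrable_mul_fderiv hc.continuous hf hfc e
  · exact (hc.continuous.mul hf.continuous).integrable_of_hasCompactSupport hfc.mul_left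
  · exact fun x _ => hc.differentiable one_ne_zero x
  · exact fun x _ => hf.differentiable one_ne_zero x

instance isAddHaarMeasure_volume_H (n : ℕ) : (volume : Measure (H n)).IsAddHaarMeasure :=
  Measure.prod.instIsAddHaarMeasure (volume : Measure (Fin n → ℝ))
    ((volume : Measure (Fin n → ℝ)).prod (volume : Measure ℝ))

/-- The vector field `hV` is divergence free. -/
theorem integral_fderiv_hV (n : ℕ) (ν : H n) {f : H n → ℝ} (hf : ContDiff ℝ 1 f)
    (hfc : HasCompactSupport f) : ∫ ξ, fderiv ℝ f ξ (hV n ν ξ) = 0 := by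
  have hcT : ∀ i, ContDiff ℝ 1
      (fun ξ : H n => 2 * (ξ.2.1 i * wX n ν i ξ - ξ.1 i * wY n ν i ξ)) := by
    intro i
    have := contDiff_wX n ν i
    have := contDiff_wY n ν i
    fun_prop
  have hiX := fun i => integrable_mul_fderiv (μ := volume) (contDiff_wX n ν i).continuous hf hfc
    (Pi.single i 1, 0, 0)
  have hiY := fun i => integrable_mul_fderiv (μ := volume) (contDiff_wY n ν i).continuous hf hfc
    (0, Pi.single i 1, 0)
  have hiT := fun i => integrable_mul_fderiv (μ := volume) (hcT i).continuous hf hfc (0, 0, 1)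
  simp_rw [hV_eq_sum_basis, map_sum, map_add, map_smul, smul_eq_mul]
  rw [integral_finsetSum _ fun i _ => by exact ((hiX i).add (hiY i)).add (hiT i)]
  refine Finset.sum_eq_zero fun i _ => ?_
  rw [integral_add (by exact (hiX i).add (hiY i)) (hiT i), integral_add (hiX i) (hiY i),
    integral_mul_fderiv_eq_zero (contDiff_wX n ν i) hf hfc,
    integral_mul_fderiv_eq_zero (contDiff_wY n ν i) hf hfc,
    integral_mul_fderiv_eq_zero (hcT i) hf hfc]
  · simp
  · intro x s; simp [wX, wY]
  · intro x s; simp [wY]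
  · intro x s; simp [wX]

theorem wSq_add_smul_hV (n : ℕ) (ν ξ : H n) (s : ℝ) :
    wSq n ν (ξ + s • hV n ν ξ) = (1 + 4 * ν.2.2 ^ 2 * s ^ 2) * wSq n ν ξ := by
  unfold wSq
  rw [Finset.mul_sum]
  refine Finset.sum_congr rfl fun i _ => ?_
  have h1 : wX n ν i (ξ + s • hV n ν ξ) = wX n ν i ξ + 2 * s * ν.2.2 * wY n ν i ξ := by
    simp only [wX, hV, Prod.snd_add, Prod.fst_add, Prod.smul_snd, Prod.smul_fst, Pi.add_apply,
      Pi.smul_apply, smul_eq_mul]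
    ring
  have h2 : wY n ν i (ξ + s • hV n ν ξ) = wY n ν i ξ - 2 * s * ν.2.2 * wX n ν i ξ := by
    simp only [wY, hV, Prod.fst_add, Prod.smul_fst, Pi.add_apply,
      Pi.smul_apply, smul_eq_mul]
    ring
  rw [h1, h2]
  ring

theorem fderiv_wSq_add_rpow_hV (n : ℕ) (ν ξ : H n) {ε : ℝ} (hε : 0 < ε) (q : ℝ) :
    fderiv ℝ (fun ζ => (wSq n ν ζ + ε) ^ q) ξ (hV n ν ξ) = 0 := by
  have hd : DifferentiableAt ℝ (fun ζ => (wSq n ν ζ + ε) ^ q) ξ :=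
    (((contDiff_wSq n ν).differentiable one_ne_zero ξ).add_const ε).rpow_const
      (Or.inl (by linarith [wSq_nonneg n ν ξ]))
  rw [← hd.lineDeriv_eq_fderiv, lineDeriv]
  simp_rw [wSq_add_smul_hV]
  have h1 : HasDerivAt (fun s : ℝ => (1 + 4 * ν.2.2 ^ 2 * s ^ 2) * wSq n ν ξ + ε) 0 0 := by
    have := (((((hasDerivAt_id (0 : ℝ)).pow 2).const_mul (4 * ν.2.2 ^ 2)).const_add 1).mul_const
      (wSq n ν ξ)).add_const ε
    simpa using this
  have h2 := h1.rpow_const (p := q) (Or.inl (by simp; linarith [wSq_nonneg n ν ξ]))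
  simpa using h2.deriv

/-- The `p`-sub-Laplacian of `⟨·, ν⟩` vanishes, in the weak sense. -/
theorem integral_wSq_rpow_mul_fderiv_hV (n : ℕ) (ν : H n) {q : ℝ} (hq : 0 ≤ q) {g : H n → ℝ}
    (hg : ContDiff ℝ 1 g) (hgc : HasCompactSupport g) :
    ∫ ξ, wSq n ν ξ ^ q * fderiv ℝ g ξ (hV n ν ξ) = 0 := by
  have hfull : ∀ φ : H n → ℝ, ∫ ξ in tsupport g, φ ξ * fderiv ℝ g ξ (hV n ν ξ)
      = ∫ ξ, φ ξ * fderiv ℝ g ξ (hV n ν ξ) := fun φ =>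
    setIntegral_eq_integral_of_forall_compl_eq_zero fun ξ hξ => by
      simp [fderiv_of_notMem_tsupport (𝕜 := ℝ) hξ]
  have hcont : Continuous fun ε : ℝ =>
      ∫ ξ in tsupport g, (wSq n ν ξ + |ε|) ^ q * fderiv ℝ g ξ (hV n ν ξ) := by
    refine continuous_parametric_integral_of_continuous ?_ hgc
    have h1 := (contDiff_wSq n ν).continuous
    have h2 := (hg.continuous_fderiv one_ne_zero).clm_apply (continuous_hV n ν)
    exact (((h1.comp continuous_snd).add (continuous_abs.comp continuous_fst)).rpow_const
      fun _ => Or.inr hq).mul (h2.comp continuous_snd)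
  have hne : Set.EqOn (fun ε : ℝ =>
      ∫ ξ in tsupport g, (wSq n ν ξ + |ε|) ^ q * fderiv ℝ g ξ (hV n ν ξ)) (fun _ => 0)
      {(0 : ℝ)}ᶜ := by
    intro ε hε
    have hε' : 0 < |ε| := abs_pos.2 hε
    have hφ : ContDiff ℝ 1 (fun ζ => (wSq n ν ζ + |ε|) ^ q) :=
      ((contDiff_wSq n ν).add contDiff_const).rpow_const_of_ne
        fun ζ => by linarith [wSq_nonneg n ν ζ]
    simp only
    rw [hfull, ← integral_fderiv_hV n ν (hφ.mul hg) hgc.mul_left]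
    refine integral_congr_ae (Filter.Eventually.of_forall fun ξ => ?_)
    simp only
    rw [fderiv_fun_mul (hφ.differentiable one_ne_zero ξ) (hg.differentiable one_ne_zero ξ)]
    simp [fderiv_wSq_add_rpow_hV n ν ξ hε' q]
  have := congrFun (hcont.ext_on (dense_compl_singleton (0 : ℝ)) continuous_const hne) 0
  simp only [abs_zero, hfull] at this
  simpa using this

theorem continuous_hNorm (n : ℕ) {f : H n → ℝ} (hf : ContDiff ℝ 1 f) :
    Continuous (hNorm n f) := by
  have h := hf.continuous_fderiv one_ne_zero
  have hX : ∀ i, Continuous (XD n i f) := fun i => h.clm_apply (by unfold Xv; fun_prop)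
  have hY : ∀ i, Continuous (YD n i f) := fun i => h.clm_apply (by unfold Yv; fun_prop)
  unfold hNorm
  fun_prop

/-- Lindqvist's inequality for the horizontal gradient of `D ^ ((p - 1) / p) * t`, where `D` and
`t` have gradients `w` and `b`. -/
theorem rpow_norm_smul_add_smul_ge {E : Type*} [NormedAddCommGroup E] [InnerProductSpace ℝ E]
    {p D : ℝ} (hp : 2 ≤ p) (hD : 0 < D) (t : ℝ) (w b : E) :
    ((p - 1) / p) ^ p * (‖w‖ ^ p / D ^ p * |D ^ ((p - 1) / p) * t| ^ p)
      + ((p - 1) / p) ^ (p - 1) * (‖w‖ ^ (p - 2) * (p * |t| ^ (p - 2) * t * inner ℝ w b))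
      + (2 ^ (p - 1) - 1)⁻¹ * (D ^ (p - 1) * ‖b‖ ^ p)
      ≤ ‖((p - 1) / p * D ^ ((p - 1) / p - 1) * t) • w + D ^ ((p - 1) / p) • b‖ ^ p := by
  have hp0 : 0 < p := by linarith
  set a := (p - 1) / p with ha
  have hapos : 0 < a := div_pos (by linarith) hp0
  have hap : a * p = p - 1 := by rw [ha]; field_simp
  refine le_trans (le_of_eq ?_) (norm_rpow_add_inner_add_le hp _ _)
  have hDa : |D ^ a * t| ^ p = D ^ (p - 1) * |t| ^ p := by
    rw [abs_mul, abs_of_pos (Real.rpow_pos_of_pos hD a),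
      Real.mul_rpow (by positivity) (by positivity), ← Real.rpow_mul hD.le, hap]
  have hA : ∀ r : ℝ, ‖(a * D ^ (a - 1) * t) • w‖ ^ r
      = a ^ r * D ^ ((a - 1) * r) * |t| ^ r * ‖w‖ ^ r := by
    intro r
    rw [norm_smul, Real.norm_eq_abs, abs_mul, abs_of_pos (by positivity),
      Real.mul_rpow (by positivity) (by positivity), Real.mul_rpow (by positivity) (by positivity),
      Real.mul_rpow (by positivity) (by positivity), ← Real.rpow_mul hD.le]
  have hB : ‖D ^ a • b‖ ^ p = D ^ (p - 1) * ‖b‖ ^ p := by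
    rw [norm_smul, Real.norm_eq_abs, abs_of_pos (by positivity),
      Real.mul_rpow (by positivity) (by positivity), ← Real.rpow_mul hD.le, hap]
  rw [hA, hA, hB, hDa, real_inner_smul_left, real_inner_smul_right]
  congr 1
  congr 1
  · have : D ^ ((a - 1) * p) = D ^ (p - 1) / D ^ p := by
      rw [← Real.rpow_sub hD]
      congr 1
      linarith
    rw [this]
    ring
  · have h1 : a ^ (p - 1) = a ^ (p - 2) * a := by
      rw [← Real.rpow_add_one hapos.ne']
      congr 1
      ring
    have h2 : D ^ ((a - 1) * (p - 2)) * D ^ (a - 1) * D ^ a = 1 := by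
      rw [← Real.rpow_add hD, ← Real.rpow_add hD]
      convert Real.rpow_zero D using 2
      linarith
    rw [h1]
    linear_combination
      (-(a ^ (p - 2) * a * ‖w‖ ^ (p - 2) * p * |t| ^ (p - 2) * t * inner ℝ w b)) * h2

theorem hardy_remainder_lower_bound (n : ℕ) (ν : H n) (hν : iprod n ν ν = 1) (d : ℝ)
    (p : ℝ) (hp : 2 ≤ p) (u v : H n → ℝ)
    (hu : ContDiff ℝ (⊤ : ℕ∞) u) (hc : HasCompactSupport u)
    (hsupp : tsupport u ⊆ {ξ : H n | d < iprod n ξ ν})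
    (hv : ContDiffOn ℝ (⊤ : ℕ∞) v {ξ : H n | d < iprod n ξ ν})
    (huv : ∀ ξ ∈ {ξ : H n | d < iprod n ξ ν},
      u ξ = (iprod n ξ ν - d) ^ ((p - 1) / p) * v ξ) :
    (∫ ξ in {ξ : H n | d < iprod n ξ ν}, hNorm n u ξ ^ p) -
      ((p - 1) / p) ^ p *
        ∫ ξ in {ξ : H n | d < iprod n ξ ν},
          hNorm n (fun ζ => iprod n ζ ν - d) ξ ^ p / (iprod n ξ ν - d) ^ p * |u ξ| ^ p ≥
      (2 ^ (p - 1) - 1)⁻¹ *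
        ∫ ξ in {ξ : H n | d < iprod n ξ ν},
          (iprod n ξ ν - d) ^ (p - 1) * hNorm n v ξ ^ p := by
  
  have hp0 : 0 < p := by linarith
  set Ω : Set (H n) := {ξ : H n | d < iprod n ξ ν} with hΩ
  set K := tsupport u with hK
  have hδc : Continuous fun ξ : H n => iprod n ξ ν - d :=
    (iprodL n ν).continuous.sub continuous_const
  have hΩo : IsOpen Ω := isOpen_lt continuous_const (iprodL n ν).continuous
  have hKm : MeasurableSet K := (isClosed_tsupport u).measurableSet
  have hδpos : ∀ ξ ∈ Ω, 0 < iprod n ξ ν - d := fun ξ hξ => sub_pos.2 hξ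
  set v₀ : H n → ℝ := Ω.indicator v with hv₀
  have hvv : ∀ ξ ∈ Ω, v₀ =ᶠ[nhds ξ] v := fun ξ hξ => by
    filter_upwards [hΩo.mem_nhds hξ] with ζ hζ
    exact Set.indicator_of_mem hζ v
  have hv₀K : ∀ ξ ∉ K, v₀ ξ = 0 := by
    intro ξ hξ
    by_cases hξΩ : ξ ∈ Ω
    · have h1 := huv ξ hξΩ
      rw [image_eq_zero_of_notMem_tsupport hξ] at h1
      rw [hv₀, Set.indicator_of_mem hξΩ]
      exact (mul_eq_zero.1 h1.symm).resolve_left (Real.rpow_pos_of_pos (hδpos ξ hξΩ) _).ne'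
    · exact Set.indicator_of_notMem hξΩ v
  have hv₀s : ContDiff ℝ 1 v₀ := by
    refine contDiff_iff_contDiffAt.2 fun ξ => ?_
    by_cases hξ : ξ ∈ K
    · exact ((hv.contDiffAt (hΩo.mem_nhds (hsupp hξ))).of_le (by simp)).congr_of_eventuallyEq
        (hvv ξ (hsupp hξ))
    · refine (contDiffAt_const (c := (0 : ℝ))).congr_of_eventuallyEq ?_
      filter_upwards [(isClosed_tsupport u).isOpen_compl.mem_nhds hξ] with ζ hζ
      exact hv₀K ζ hζ
  have hv₀c : HasCompactSupport v₀ := HasCompactSupport.intro hc hv₀K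
  have hhv : ∀ ξ ∈ Ω, hNorm n v ξ = hNorm n v₀ ξ := fun ξ hξ => by
    rw [hNorm_eq_norm_hProj, hNorm_eq_norm_hProj, (hvv ξ hξ).fderiv_eq]
  have hhW : ∀ ξ, hNorm n (fun ζ => iprod n ζ ν - d) ξ = ‖hProj n ξ (iprodL n ν)‖ := fun ξ => by
    rw [hNorm_eq_norm_hProj, (hasFDerivAt_iprod_sub n ν ξ d).fderiv]
  have hzero : ∀ (f : H n → ℝ) ξ, ξ ∉ tsupport f → hNorm n f ξ ^ p = 0 := by
    intro f ξ hξ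
    rw [hNorm_eq_norm_hProj, fderiv_of_notMem_tsupport (𝕜 := ℝ) hξ, map_zero, norm_zero,
      Real.zero_rpow hp0.ne']
  have hv₀t : tsupport v₀ ⊆ K :=
    closure_minimal (fun ξ hξ => by_contra fun h => hξ (hv₀K ξ h)) (isClosed_tsupport u)
  have hu1 : ContDiff ℝ 1 u := hu.of_le (by simp)
  -- All integrals live on the compact set `K`.
  rw [setIntegral_eq_of_subset_of_forall_sdiff_eq_zero hΩo.measurableSet hsupp
      fun ξ hξ => hzero u ξ hξ.2,
    setIntegral_eq_of_subset_of_forall_sdiff_eq_zero hΩo.measurableSet hsupp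
      fun ξ hξ => by
        rw [image_eq_zero_of_notMem_tsupport hξ.2, abs_zero, Real.zero_rpow hp0.ne', mul_zero],
    setIntegral_eq_of_subset_of_forall_sdiff_eq_zero hΩo.measurableSet hsupp
      fun ξ hξ => by
        rw [hhv ξ hξ.1, hzero v₀ ξ fun h => hξ.2 (hv₀t h), mul_zero],
    setIntegral_congr_fun hKm
      (f := fun ξ => (iprod n ξ ν - d) ^ (p - 1) * hNorm n v ξ ^ p)
      (g := fun ξ => (iprod n ξ ν - d) ^ (p - 1) * hNorm n v₀ ξ ^ p)
      fun ξ hξ => by simp only [hhv ξ (hsupp hξ)]]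
  set g : H n → ℝ := fun ξ => |v₀ ξ| ^ p with hg
  have hgs : ContDiff ℝ 1 g := hv₀s.norm_rpow (by linarith)
  have hgc : HasCompactSupport g :=
    hv₀c.comp_left (g := fun t => |t| ^ p) (by simp [Real.zero_rpow hp0.ne'])
  have hgt : tsupport g ⊆ K := by
    refine closure_minimal (fun ξ hξ => by_contra fun h => hξ ?_) (isClosed_tsupport u)
    simp [hg, hv₀K ξ h, Real.zero_rpow hp0.ne']
  have hcross : ∫ ξ in K, wSq n ν ξ ^ ((p - 2) / 2) * fderiv ℝ g ξ (hV n ν ξ) = 0 := by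
    rw [setIntegral_eq_integral_of_forall_compl_eq_zero fun ξ hξ => by
      simp [fderiv_of_notMem_tsupport (𝕜 := ℝ) fun h => hξ (hgt h)]]
    exact integral_wSq_rpow_mul_fderiv_hV n ν (by linarith) hgs hgc
  have hI1 : IntegrableOn (fun ξ => hNorm n u ξ ^ p) K :=
    ((continuous_hNorm n hu1).rpow_const fun _ => Or.inr hp0.le).continuousOn.integrableOn_compact hc
  have hI2 : IntegrableOn (fun ξ => hNorm n (fun ζ => iprod n ζ ν - d) ξ ^ p
      / (iprod n ξ ν - d) ^ p * |u ξ| ^ p) K := by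
    refine ContinuousOn.integrableOn_compact hc ?_
    have hW : Continuous (hNorm n fun ζ => iprod n ζ ν - d) :=
      continuous_hNorm n ((iprodL n ν).contDiff.sub contDiff_const)
    refine ((hW.rpow_const fun _ => Or.inr hp0.le).continuousOn.div
      (hδc.rpow_const fun _ => Or.inr hp0.le).continuousOn fun ξ hξ => ?_).mul
      (hu1.continuous.abs.rpow_const fun _ => Or.inr hp0.le).continuousOn
    exact (Real.rpow_pos_of_pos (hδpos ξ (hsupp hξ)) _).ne'
  have hI3 : IntegrableOn (fun ξ => wSq n ν ξ ^ ((p - 2) / 2) * fderiv ℝ g ξ (hV n ν ξ)) K :=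
    ((((contDiff_wSq n ν).continuous.rpow_const fun _ => Or.inr (by linarith)).mul
      ((hgs.continuous_fderiv one_ne_zero).clm_apply
        (continuous_hV n ν))).continuousOn).integrableOn_compact hc
  have hI4 : IntegrableOn (fun ξ => (iprod n ξ ν - d) ^ (p - 1) * hNorm n v₀ ξ ^ p) K :=
    ((hδc.rpow_const fun _ => Or.inr (by linarith)).mul
      ((continuous_hNorm n hv₀s).rpow_const
        fun _ => Or.inr hp0.le)).continuousOn.integrableOn_compact hc
  have hpt : ∀ ξ ∈ K, ((p - 1) / p) ^ p * (hNorm n (fun ζ => iprod n ζ ν - d) ξ ^ p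
        / (iprod n ξ ν - d) ^ p * |u ξ| ^ p)
      + ((p - 1) / p) ^ (p - 1) * (wSq n ν ξ ^ ((p - 2) / 2) * fderiv ℝ g ξ (hV n ν ξ))
      + (2 ^ (p - 1) - 1)⁻¹ * ((iprod n ξ ν - d) ^ (p - 1) * hNorm n v₀ ξ ^ p)
      ≤ hNorm n u ξ ^ p := by
    intro ξ hξ
    have hξΩ := hsupp hξ
    have hD := hδpos ξ hξΩ
    have hv₀d : HasFDerivAt v₀ (fderiv ℝ v₀ ξ) ξ :=
      (hv₀s.differentiable one_ne_zero ξ).hasFDerivAt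
    have hud : fderiv ℝ u ξ
        = ((p - 1) / p * (iprod n ξ ν - d) ^ ((p - 1) / p - 1) * v₀ ξ) • iprodL n ν
          + (iprod n ξ ν - d) ^ ((p - 1) / p) • fderiv ℝ v₀ ξ := by
      have h1 := ((hasFDerivAt_iprod_sub n ν ξ d).rpow_const (p := (p - 1) / p)
        (Or.inl hD.ne')).mul hv₀d
      have h2 : u =ᶠ[nhds ξ] fun ζ => (iprod n ζ ν - d) ^ ((p - 1) / p) * v₀ ζ := by
        filter_upwards [hΩo.mem_nhds hξΩ] with ζ hζ
        rw [huv ζ hζ, hv₀, Set.indicator_of_mem hζ]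
      rw [(h1.congr_of_eventuallyEq h2).fderiv, smul_smul, add_comm]
      congr 2
      ring
    have hgd : fderiv ℝ g ξ = (p * |v₀ ξ| ^ (p - 2) * v₀ ξ) • fderiv ℝ v₀ ξ :=
      ((hasDerivAt_abs_rpow (v₀ ξ) (by linarith)).comp_hasFDerivAt ξ hv₀d).fderiv
    have hwS : wSq n ν ξ ^ ((p - 2) / 2) = ‖hProj n ξ (iprodL n ν)‖ ^ (p - 2) := by
      rw [← norm_hProj_iprodL_sq, ← Real.rpow_natCast, ← Real.rpow_mul (norm_nonneg _)]
      congr 1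
      push_cast
      ring
    have huξ : u ξ = (iprod n ξ ν - d) ^ ((p - 1) / p) * v₀ ξ := by
      rw [huv ξ hξΩ, hv₀, Set.indicator_of_mem hξΩ]
    rw [hhW, hNorm_eq_norm_hProj n u, hud, map_add, map_smul, map_smul, hgd, hwS, huξ,
      hNorm_eq_norm_hProj n v₀, smul_apply, smul_eq_mul, ← inner_hProj_iprodL]
    exact rpow_norm_smul_add_smul_ge hp hD _ _ _
  have hmono := setIntegral_mono_on (((hI2.const_mul (((p - 1) / p) ^ p)).add
    (hI3.const_mul (((p - 1) / p) ^ (p - 1)))).add (hI4.const_mul (2 ^ (p - 1) - 1)⁻¹)) hI1 hKm hpt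
  simp only [Pi.add_apply] at hmono
  rw [integral_add (by exact (hI2.const_mul _).add (hI3.const_mul _)) (hI4.const_mul _),
    integral_add (hI2.const_mul _) (hI3.const_mul _), integral_const_mul, integral_const_mul,
    integral_const_mul, hcross] at hmono
  linarith
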